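/- Let T be a nondegenerate triangle in ℝ² with vertices x₁, x₂, x₃ and let 𝒮 be a finite collection of closed segments, each with both endpoints on ∂T and no interior point on ∂T, such that whenever two distinct segments of 𝒮̄ = 𝒮 ∪ {x₁x₂, x₂x₃, x₃x₁} intersect at a point p ∉ {x₁, x₂, x₃}, there is a unique third segment of 𝒮̄ passing through p. If v lies in the interior of an edge of T and uv, wv ∈ 𝒮 are two distinct segments with common endpoint v, then u and w do not both lie on the same edge of T. -/

import Mathlib

open Set

/-- The boundary of the triangle with vertices `x1`, `x2`, `x3`. -/
def triBdry (x1 x2 x3 : ℝ × ℝ) : Set (ℝ × ℝ) :=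
  segment ℝ x1 x2 ∪ segment ℝ x2 x3 ∪ segment ℝ x3 x1

/-- The three edges of the triangle with vertices `x1`, `x2`, `x3`. -/
def triEdges (x1 x2 x3 : ℝ × ℝ) : Set (Set (ℝ × ℝ)) :=
  {segment ℝ x1 x2, segment ℝ x2 x3, segment ℝ x3 x1}

/-- Twice the signed area of the triangle `A B C`. -/
def area2 (A B C : ℝ × ℝ) : ℝ :=
  (B.1 - A.1) * (C.2 - A.2) - (B.2 - A.2) * (C.1 - A.1)

/-- `s` is the intersection of `K` with a line. -/
def IsChord (K s : Set (ℝ × ℝ)) : Prop :=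
  ∃ X Y : ℝ × ℝ, X ≠ Y ∧ s = {p ∈ K | area2 X Y p = 0}

lemma area2_combo (X Y B C : ℝ × ℝ) {a b : ℝ} (hab : a + b = 1) :
    area2 X Y (a • B + b • C) = a * area2 X Y B + b * area2 X Y C := by
  obtain rfl : a = 1 - b := by linarith
  simp only [area2, Prod.fst_add, Prod.snd_add, Prod.smul_fst, Prod.smul_snd, smul_eq_mul]
  ring

lemma area2_rotate (A B C : ℝ × ℝ) : area2 A B C = area2 B C A := by
  simp only [area2]; ring

lemma area2_swap (A B C : ℝ × ℝ) : area2 A B C = -area2 A C B := by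
  simp only [area2]; ring

/-- Three points on a common line through two distinct points are collinear. -/
lemma area2_eq_zero_of_collinear {X Y P Q R : ℝ × ℝ} (hXY : X ≠ Y)
    (hP : area2 X Y P = 0) (hQ : area2 X Y Q = 0) (hR : area2 X Y R = 0) :
    area2 P Q R = 0 := by
  have h : Y.1 - X.1 ≠ 0 ∨ Y.2 - X.2 ≠ 0 := by
    by_contra! h
    exact hXY (Prod.ext (by linarith [h.1]) (by linarith [h.2]))
  simp only [area2] at *
  rcases h with h | h
  · apply mul_left_cancel₀ h
    linear_combination (R.1 - Q.1) * hP + (P.1 - R.1) * hQ + (Q.1 - P.1) * hR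
  · apply mul_left_cancel₀ h
    linear_combination (R.2 - Q.2) * hP + (P.2 - R.2) * hQ + (Q.2 - P.2) * hR

lemma area2_line {X Y P Q R : ℝ × ℝ} (hPQ : P ≠ Q)
    (hP : area2 X Y P = 0) (hQ : area2 X Y Q = 0) (hR : area2 P Q R = 0) :
    area2 X Y R = 0 := by
  have h : Q.1 - P.1 ≠ 0 ∨ Q.2 - P.2 ≠ 0 := by
    by_contra! h
    exact hPQ (Prod.ext (by linarith [h.1]) (by linarith [h.2]))
  simp only [area2] at *
  rcases h with h | h
  · apply mul_left_cancel₀ h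
    linear_combination (Q.1 - R.1) * hP + (R.1 - P.1) * hQ + (Y.1 - X.1) * hR
  · apply mul_left_cancel₀ h
    linear_combination (Q.2 - R.2) * hP + (R.2 - P.2) * hQ + (Y.2 - X.2) * hR

namespace IsChord

variable {K s t : Set (ℝ × ℝ)} {P Q R : ℝ × ℝ}

lemma subset (hs : IsChord K s) : s ⊆ K := by
  obtain ⟨X, Y, -, rfl⟩ := hs
  exact fun p hp => hp.1

lemma eq_setOf (hs : IsChord K s) (hP : P ∈ s) (hQ : Q ∈ s) (hPQ : P ≠ Q) :
    s = {p ∈ K | area2 P Q p = 0} := by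
  obtain ⟨X, Y, hXY, rfl⟩ := hs
  ext R
  exact ⟨fun h => ⟨h.1, area2_eq_zero_of_collinear hXY hP.2 hQ.2 h.2⟩,
    fun h => ⟨h.1, area2_line hPQ hP.2 hQ.2 h.2⟩⟩

lemma eq_of_mem (hs : IsChord K s) (ht : IsChord K t) (hPQ : P ≠ Q)
    (hPs : P ∈ s) (hQs : Q ∈ s) (hPt : P ∈ t) (hQt : Q ∈ t) : s = t :=
  (hs.eq_setOf hPs hQs hPQ).trans (ht.eq_setOf hPt hQt hPQ).symm

lemma area2_eq_zero (hs : IsChord K s) (hP : P ∈ s) (hQ : Q ∈ s) (hR : R ∈ s) :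
    area2 P Q R = 0 := by
  obtain ⟨X, Y, hXY, rfl⟩ := hs
  exact area2_eq_zero_of_collinear hXY hP.2 hQ.2 hR.2

end IsChord

/-- A nondegenerate triangle `A B C` with sides on members of `𝒞`, together with a cevian `A D`
on a member of `𝒞`. -/
structure CevianTriangle (𝒞 : Set (Set (ℝ × ℝ))) (A B C D : ℝ × ℝ) : Prop where
  area_ne : area2 A B C ≠ 0
  mem_open : D ∈ openSegment ℝ B C
  side_AB : ∃ s ∈ 𝒞, A ∈ s ∧ B ∈ s
  side_AC : ∃ s ∈ 𝒞, A ∈ s ∧ C ∈ s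
  side_BC : ∃ s ∈ 𝒞, B ∈ s ∧ C ∈ s
  cevian : ∃ s ∈ 𝒞, A ∈ s ∧ D ∈ s

lemma CevianTriangle.swap {𝒞 : Set (Set (ℝ × ℝ))} {A B C D : ℝ × ℝ}
    (h : CevianTriangle 𝒞 A B C D) : CevianTriangle 𝒞 A C B D where
  area_ne := by rw [area2_swap]; exact neg_ne_zero.2 h.area_ne
  mem_open := by rw [openSegment_symm]; exact h.mem_open
  side_AB := h.side_AC
  side_AC := h.side_AB
  side_BC := h.side_BC.imp fun _ hs => ⟨hs.1, hs.2.2, hs.2.1⟩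
  cevian := h.cevian

/-- A zero of an affine function lying strictly between points where it has opposite signs. -/
lemma exists_mem_openSegment_area2_eq_zero {X Y A C : ℝ × ℝ}
    (h : area2 X Y A * area2 X Y C < 0) :
    ∃ E ∈ openSegment ℝ A C, area2 X Y E = 0 := by
  set a := area2 X Y A with ha
  set c := area2 X Y C with hc
  have hac : 0 < (a - c) ^ 2 := by nlinarith [sq_nonneg (a + c)]
  have h0 : a - c ≠ 0 := fun h0 => by simp [h0] at hac
  have h1 : 0 < -c / (a - c) := by
    have : -c / (a - c) = (c ^ 2 - a * c) / (a - c) ^ 2 := by field_simp; ring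
    rw [this]
    exact div_pos (by nlinarith [sq_nonneg c]) hac
  have h2 : 0 < a / (a - c) := by
    have : a / (a - c) = (a ^ 2 - a * c) / (a - c) ^ 2 := by field_simp
    rw [this]
    exact div_pos (by nlinarith [sq_nonneg a]) hac
  have h3 : -c / (a - c) + a / (a - c) = 1 := by field_simp; ring
  refine ⟨_, ⟨_, _, h1, h2, h3, rfl⟩, ?_⟩
  rw [area2_combo _ _ _ _ h3, ← ha, ← hc]
  field_simp
  ring

section Descent

variable {K : Set (ℝ × ℝ)} {𝒞 : Set (Set (ℝ × ℝ))} {A B C D : ℝ × ℝ}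

/-- A chord through the foot `D` of the cevian that leaves `A` on the side of `B` cuts off a
smaller triangle with a cevian. -/
lemma CevianTriangle.exists_smaller_of_pos (hK : Convex ℝ K)
    (hchord : ∀ s ∈ 𝒞, IsChord K s)
    (h : CevianTriangle 𝒞 A B C D) {r : Set (ℝ × ℝ)} (hr : r ∈ 𝒞) (hDr : D ∈ r)
    {X Y : ℝ × ℝ} (hrXY : r = {p ∈ K | area2 X Y p = 0})
    (hAB : 0 < area2 X Y A * area2 X Y B) :
    ∃ E, CevianTriangle 𝒞 D A C E ∧ |area2 D A C| < |area2 A B C| := by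
  obtain ⟨sAC, hsAC, hA, hC⟩ := h.side_AC
  obtain ⟨sBC, hsBC, hB, hC'⟩ := h.side_BC
  obtain ⟨b, c, hb, hc, hbc, hD⟩ := h.mem_open
  have hDzero : b * area2 X Y B + c * area2 X Y C = 0 := by
    rw [← area2_combo _ _ _ _ hbc, hD]
    rw [hrXY] at hDr
    exact hDr.2
  have hAC : area2 X Y A * area2 X Y C < 0 := by
    have : c * (area2 X Y A * area2 X Y C) = -(b * (area2 X Y A * area2 X Y B)) := by
      linear_combination area2 X Y A * hDzero
    have := mul_pos hb hAB
    by_contra! hcon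
    have := mul_nonneg hc.le hcon
    linarith
  obtain ⟨E, hE, hE0⟩ := exists_mem_openSegment_area2_eq_zero hAC
  have hAK := (hchord _ hsAC).subset hA
  have hCK := (hchord _ hsAC).subset hC
  have hBK := (hchord _ hsBC).subset hB
  have harea : area2 D A C = -(b * area2 A B C) := by
    rw [area2_rotate, ← hD, area2_combo _ _ _ _ hbc]
    simp only [area2]; ring
  have hDs : D ∈ sBC := by
    have hDK : D ∈ K := (hchord _ hr).subset hDr
    have hBC : B ≠ C := by
      rintro rfl
      apply h.area_ne
      simp only [area2]; ring
    rw [(hchord _ hsBC).eq_setOf hB hC' hBC]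
    refine ⟨hDK, ?_⟩
    rw [← hD, area2_combo _ _ _ _ hbc]
    simp only [area2]; ring
  refine ⟨E, ⟨?_, hE, ?_, ⟨sBC, hsBC, hDs, hC'⟩, ⟨sAC, hsAC, hA, hC⟩, r, hr, hDr, ?_⟩, ?_⟩
  · rw [harea]; exact neg_ne_zero.2 (mul_ne_zero hb.ne' h.area_ne)
  · exact h.cevian.imp fun _ hs => ⟨hs.1, hs.2.2, hs.2.1⟩
  · rw [hrXY]
    exact ⟨hK.openSegment_subset hAK hCK hE, hE0⟩
  · rw [harea, abs_neg, abs_mul, abs_of_pos hb]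
    have := abs_pos.2 h.area_ne
    nlinarith

lemma CevianTriangle.exists_smaller (hK : Convex ℝ K)
    (hchord : ∀ s ∈ 𝒞, IsChord K s)
    (hthird : ∀ s₁ ∈ 𝒞, ∀ s₂ ∈ 𝒞, s₁ ≠ s₂ → ∀ p ∈ s₁ ∩ s₂, p ∉ K.extremePoints ℝ →
      ∃ s₃ ∈ 𝒞, s₃ ≠ s₁ ∧ s₃ ≠ s₂ ∧ p ∈ s₃)
    (h : CevianTriangle 𝒞 A B C D) :
    ∃ A' B' C' D', CevianTriangle 𝒞 A' B' C' D' ∧ |area2 A' B' C'| < |area2 A B C| := by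
  obtain ⟨sBC, hsBC, hB, hC⟩ := h.side_BC
  obtain ⟨sAD, hsAD, hA, hD⟩ := h.cevian
  have hBK := (hchord _ hsBC).subset hB
  have hCK := (hchord _ hsBC).subset hC
  have hBC : B ≠ C := by
    rintro rfl
    apply h.area_ne
    simp only [area2]; ring
  have hDB : D ≠ B := by
    rintro rfl
    exact hBC (left_mem_openSegment_iff.1 h.mem_open)
  have hDC : D ≠ C := by
    rintro rfl
    exact hBC (right_mem_openSegment_iff.1 h.mem_open)
  obtain ⟨b, c, hb, hc, hbc, hDeq⟩ := h.mem_open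
  have hDs : D ∈ sBC := by
    rw [(hchord _ hsBC).eq_setOf hB hC hBC]
    refine ⟨(hchord _ hsAD).subset hD, ?_⟩
    rw [← hDeq, area2_combo _ _ _ _ hbc]
    simp only [area2]; ring
  have hAs : A ∉ sBC := fun hA' => h.area_ne ((hchord _ hsBC).area2_eq_zero hA' hB hC)
  have hDA : D ≠ A := fun e => hAs (e ▸ hDs)
  have hext : D ∉ K.extremePoints ℝ := fun hx =>
    hDB (hx.2 hBK hCK h.mem_open).symm
  obtain ⟨r, hr, hr1, hr2, hDr⟩ := hthird sBC hsBC sAD hsAD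
    (fun e => hAs (e ▸ hA)) D ⟨hDs, hD⟩ hext
  have hBr : B ∉ r := fun hx => hr1 ((hchord _ hr).eq_of_mem (hchord _ hsBC) hDB hDr hx hDs hB)
  have hAr : A ∉ r := fun hx => hr2 ((hchord _ hr).eq_of_mem (hchord _ hsAD) hDA hDr hx hD hA)
  obtain ⟨X, Y, -, hrXY⟩ := hchord _ hr
  have hA0 : area2 X Y A ≠ 0 := fun h0 =>
    hAr (hrXY ▸ ⟨(hchord _ hsAD).subset hA, h0⟩)
  have hB0 : area2 X Y B ≠ 0 := fun h0 => hBr (hrXY ▸ ⟨hBK, h0⟩)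
  rcases (mul_ne_zero hA0 hB0).lt_or_gt with hneg | hpos
  · have hDzero : b * area2 X Y B + c * area2 X Y C = 0 := by
      rw [← area2_combo _ _ _ _ hbc, hDeq]
      rw [hrXY] at hDr
      exact hDr.2
    have hpos : 0 < area2 X Y A * area2 X Y C := by
      have : c * (area2 X Y A * area2 X Y C) = -(b * (area2 X Y A * area2 X Y B)) := by
        linear_combination area2 X Y A * hDzero
      have := mul_neg_of_pos_of_neg hb hneg
      exact pos_of_mul_pos_right (by linarith) hc.le
    obtain ⟨E, hE, hlt⟩ := h.swap.exists_smaller_of_pos hK hchord hr hDr hrXY hpos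
    rw [area2_swap A C B, abs_neg] at hlt
    exact ⟨_, _, _, _, hE, hlt⟩
  · obtain ⟨E, hE, hlt⟩ := h.exists_smaller_of_pos hK hchord hr hDr hrXY hpos
    exact ⟨_, _, _, _, hE, hlt⟩

/-- In a finite family of chords of a convex set where each crossing at a non-extreme point lies
on a third chord, no triangle formed by chords is cut by a chord through one of its corners. -/
theorem not_cevianTriangle (hK : Convex ℝ K) (hfin : 𝒞.Finite)
    (hchord : ∀ s ∈ 𝒞, IsChord K s)
    (hthird : ∀ s₁ ∈ 𝒞, ∀ s₂ ∈ 𝒞, s₁ ≠ s₂ → ∀ p ∈ s₁ ∩ s₂, p ∉ K.extremePoints ℝ →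
      ∃ s₃ ∈ 𝒞, s₃ ≠ s₁ ∧ s₃ ≠ s₂ ∧ p ∈ s₃) :
    ¬ CevianTriangle 𝒞 A B C D := by
  intro h
  set P : Set (ℝ × ℝ) := ⋃ s ∈ 𝒞, ⋃ t ∈ 𝒞, {p | s ≠ t ∧ p ∈ s ∧ p ∈ t} with hP
  have hPfin : P.Finite := by
    refine hfin.biUnion fun s hs => hfin.biUnion fun t ht => Set.Subsingleton.finite ?_
    intro p hp q hq
    by_contra hpq
    exact hp.1 ((hchord _ hs).eq_of_mem (hchord _ ht) hpq hp.2.1 hq.2.1 hp.2.2 hq.2.2)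
  have hmem : ∀ {s t : Set (ℝ × ℝ)} {p q r : ℝ × ℝ}, s ∈ 𝒞 → t ∈ 𝒞 → p ∈ s → q ∈ s →
      p ∈ t → r ∈ t → area2 p q r ≠ 0 → p ∈ P := by
    intro s t p q r hs ht hps hqs hpt hrt hne
    simp only [hP, Set.mem_iUnion]
    refine ⟨s, hs, t, ht, ?_, hps, hpt⟩
    rintro rfl
    exact hne ((hchord _ hs).area2_eq_zero hps hqs hrt)
  set Q : Set ((ℝ × ℝ) × (ℝ × ℝ) × (ℝ × ℝ)) :=
    {q | ∃ D, CevianTriangle 𝒞 q.1 q.2.1 q.2.2 D} with hQ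
  have hQfin : Q.Finite := by
    refine (hPfin.prod (hPfin.prod hPfin)).subset ?_
    rintro ⟨A, B, C⟩ ⟨D, hq⟩
    obtain ⟨s, hs, hAs, hBs⟩ := hq.side_AB
    obtain ⟨t, ht, hAt, hCt⟩ := hq.side_AC
    obtain ⟨r, hr, hBr, hCr⟩ := hq.side_BC
    refine ⟨hmem hs ht hAs hBs hAt hCt hq.area_ne, hmem hr hs hBr hCr hBs hAs ?_,
      hmem ht hr hCt hAt hCr hBr ?_⟩
    · rw [← area2_rotate]; exact hq.area_ne
    · rw [area2_rotate]; exact hq.area_ne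
  obtain ⟨⟨A', B', C'⟩, ⟨D', h'⟩, hmin⟩ := Set.exists_min_image Q
    (fun q => |area2 q.1 q.2.1 q.2.2|) hQfin ⟨(A, B, C), D, h⟩
  obtain ⟨A'', B'', C'', D'', h'', hlt⟩ := h'.exists_smaller hK hchord hthird
  exact absurd (hmin (A'', B'', C'') ⟨D'', h''⟩) (not_le.2 hlt)

/-- Two chords from an interior point `v` of a chord `a b` cannot both end on another chord
through `b`. -/
theorem no_two_chords_to_adjacent (hK : Convex ℝ K) (hfin : 𝒞.Finite)
    (hchord : ∀ s ∈ 𝒞, IsChord K s)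
    (hthird : ∀ s₁ ∈ 𝒞, ∀ s₂ ∈ 𝒞, s₁ ≠ s₂ → ∀ p ∈ s₁ ∩ s₂, p ∉ K.extremePoints ℝ →
      ∃ s₃ ∈ 𝒞, s₃ ≠ s₁ ∧ s₃ ≠ s₂ ∧ p ∈ s₃)
    {a b c v u w : ℝ × ℝ} (habc : area2 a b c ≠ 0)
    (hab : segment ℝ a b ∈ 𝒞) (hbc : segment ℝ b c ∈ 𝒞) (hv : v ∈ openSegment ℝ a b)
    (hu : u ∈ segment ℝ b c) (hw : w ∈ segment ℝ b c) (hub : u ≠ b) (hwb : w ≠ b) (huw : u ≠ w)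
    (huv : segment ℝ u v ∈ 𝒞) (hwv : segment ℝ w v ∈ 𝒞) : False := by
  have key : ∀ {u w : ℝ × ℝ}, w ∈ segment ℝ b c → w ≠ b → u ∈ openSegment ℝ b w →
      segment ℝ u v ∈ 𝒞 → segment ℝ w v ∈ 𝒞 → False := by
    intro u w hw hwb hu huv hwv
    have harea : area2 v b w ≠ 0 := by
      obtain ⟨p, q, hp, hq, hpq, rfl⟩ := hv
      obtain ⟨m, n, hm, hn, hmn, rfl⟩ := hw
      have hn0 : n ≠ 0 := by
        rintro rfl
        obtain rfl : m = 1 := by linarith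
        simp at hwb
      rw [area2_rotate, area2_rotate, area2_rotate, area2_combo _ _ _ _ hmn,
        area2_rotate _ b b, area2_rotate _ b c, area2_combo _ _ _ _ hpq,
        area2_combo _ _ _ _ hpq]
      have e : m * (p * area2 b b a + q * area2 b b b) + n * (p * area2 b c a + q * area2 b c b)
          = n * (p * area2 a b c) := by
        simp only [area2]; ring
      rw [e]
      exact mul_ne_zero hn0 (mul_ne_zero hp.ne' habc)
    exact not_cevianTriangle hK hfin hchord hthird
      (⟨harea, hu, ⟨_, hab, openSegment_subset_segment _ _ _ hv, right_mem_segment _ _ _⟩,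
        ⟨_, hwv, right_mem_segment _ _ _, left_mem_segment _ _ _⟩,
        ⟨_, hbc, left_mem_segment _ _ _, hw⟩,
        ⟨_, huv, right_mem_segment _ _ _, left_mem_segment _ _ _⟩⟩ :
        CevianTriangle 𝒞 v b w u)
  have hbet : ∀ {m n : ℝ}, 0 < m → m < n → b + m • (c - b) ∈ openSegment ℝ b (b + n • (c - b)) := by
    intro m n hm hmn
    have hn : n ≠ 0 := by linarith
    rw [openSegment_eq_image_lineMap]
    refine ⟨m / n, ⟨div_pos hm (hm.trans hmn), (div_lt_one (hm.trans hmn)).2 hmn⟩, ?_⟩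
    simp [AffineMap.lineMap_apply, smul_smul, div_mul_cancel₀ _ hn, add_comm]
  have hu' := hu
  have hw' := hw
  rw [segment_eq_image'] at hu' hw'
  obtain ⟨m, ⟨hm, -⟩, rfl⟩ := hu'
  obtain ⟨n, ⟨hn, -⟩, rfl⟩ := hw'
  have hm0 : 0 < m := hm.lt_of_ne (by rintro rfl; simp at hub)
  have hn0 : 0 < n := hn.lt_of_ne (by rintro rfl; simp at hwb)
  rcases lt_trichotomy m n with hlt | rfl | hlt
  · exact key hw hwb (hbet hm0 hlt) huv hwv
  · exact huw rfl
  · exact key hu hub (hbet hn0 hlt) hwv huv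

end Descent

section Triangle

variable {x₁ x₂ x₃ : ℝ × ℝ}

/-- The closed triangle, as an intersection of half-planes. -/
def triSolid (x₁ x₂ x₃ : ℝ × ℝ) : Set (ℝ × ℝ) :=
  {p | 0 ≤ area2 x₁ x₂ p / area2 x₁ x₂ x₃ ∧ 0 ≤ area2 x₂ x₃ p / area2 x₁ x₂ x₃ ∧
    0 ≤ area2 x₃ x₁ p / area2 x₁ x₂ x₃}

lemma triSolid_rotate (x₁ x₂ x₃ : ℝ × ℝ) : triSolid x₂ x₃ x₁ = triSolid x₁ x₂ x₃ := by
  ext p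
  simp only [triSolid, Set.mem_ofPred_eq, ← area2_rotate x₁ x₂ x₃]
  tauto

lemma convex_triSolid (x₁ x₂ x₃ : ℝ × ℝ) : Convex ℝ (triSolid x₁ x₂ x₃) := by
  rintro p ⟨hp1, hp2, hp3⟩ q ⟨hq1, hq2, hq3⟩ a b ha hb hab
  have key : ∀ X Y : ℝ × ℝ, 0 ≤ area2 X Y p / area2 x₁ x₂ x₃ →
      0 ≤ area2 X Y q / area2 x₁ x₂ x₃ →
      0 ≤ area2 X Y (a • p + b • q) / area2 x₁ x₂ x₃ := by
    intro X Y h1 h2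
    rw [area2_combo _ _ _ _ hab, add_div, mul_div_assoc, mul_div_assoc]
    positivity
  exact ⟨key _ _ hp1 hq1, key _ _ hp2 hq2, key _ _ hp3 hq3⟩

lemma segment_eq_triSolid_inter (h : area2 x₁ x₂ x₃ ≠ 0) :
    segment ℝ x₁ x₂ = {p ∈ triSolid x₁ x₂ x₃ | area2 x₁ x₂ p = 0} := by
  ext p
  constructor
  · rintro ⟨a, b, ha, hb, hab, rfl⟩
    have h1 : area2 x₁ x₂ (a • x₁ + b • x₂) = 0 := by
      rw [area2_combo _ _ _ _ hab]; simp only [area2]; ring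
    have h2 : area2 x₂ x₃ (a • x₁ + b • x₂) / area2 x₁ x₂ x₃ = a := by
      rw [area2_combo _ _ _ _ hab, ← area2_rotate, div_eq_iff h]; simp only [area2]; ring
    have h3 : area2 x₃ x₁ (a • x₁ + b • x₂) / area2 x₁ x₂ x₃ = b := by
      rw [area2_combo _ _ _ _ hab, div_eq_iff h]; simp only [area2]; ring
    exact ⟨⟨by simp [h1], ha.trans_eq h2.symm, hb.trans_eq h3.symm⟩, h1⟩
  · rintro ⟨⟨-, h2, h3⟩, h1⟩
    refine ⟨_, _, h2, h3, ?_, ?_⟩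
    · rw [← add_div, div_eq_one_iff_eq h]
      simp only [area2] at *
      linear_combination -h1
    · ext
      · simp only [Prod.fst_add, Prod.smul_fst, smul_eq_mul]
        rw [div_mul_eq_mul_div, div_mul_eq_mul_div, ← add_div, div_eq_iff h]
        simp only [area2] at *
        linear_combination -x₃.1 * h1
      · simp only [Prod.snd_add, Prod.smul_snd, smul_eq_mul]
        rw [div_mul_eq_mul_div, div_mul_eq_mul_div, ← add_div, div_eq_iff h]
        simp only [area2] at *
        linear_combination -x₃.2 * h1

lemma ne_of_area2_ne_zero (h : area2 x₁ x₂ x₃ ≠ 0) : x₁ ≠ x₂ := by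
  rintro rfl
  exact h (by simp only [area2]; ring)

lemma isChord_of_mem_triEdges (h : area2 x₁ x₂ x₃ ≠ 0) {e : Set (ℝ × ℝ)}
    (he : e ∈ triEdges x₁ x₂ x₃) : IsChord (triSolid x₁ x₂ x₃) e := by
  have h' : area2 x₂ x₃ x₁ ≠ 0 := by rwa [← area2_rotate]
  have h'' : area2 x₃ x₁ x₂ ≠ 0 := by rwa [area2_rotate]
  rcases he with rfl | rfl | rfl
  · exact ⟨_, _, ne_of_area2_ne_zero h, segment_eq_triSolid_inter h⟩
  · rw [← triSolid_rotate]
    exact ⟨_, _, ne_of_area2_ne_zero h', segment_eq_triSolid_inter h'⟩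
  · rw [← triSolid_rotate, ← triSolid_rotate]
    exact ⟨_, _, ne_of_area2_ne_zero h'', segment_eq_triSolid_inter h''⟩

lemma subset_triBdry_of_mem_triEdges {e : Set (ℝ × ℝ)}
    (he : e ∈ triEdges x₁ x₂ x₃) : e ⊆ triBdry x₁ x₂ x₃ := by
  intro p hp
  rcases he with rfl | rfl | rfl
  · exact Or.inl (Or.inl hp)
  · exact Or.inl (Or.inr hp)
  · exact Or.inr hp

/-- Edges are faces of the triangle. -/
lemma isExtreme_segment (h : area2 x₁ x₂ x₃ ≠ 0) :
    IsExtreme ℝ (triSolid x₁ x₂ x₃) (segment ℝ x₁ x₂) := by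
  rw [segment_eq_triSolid_inter h]
  refine ⟨fun p hp => hp.1, ?_⟩
  rintro p hp q hq _ ⟨-, hz⟩ ⟨a, b, ha, hb, hab, rfl⟩
  refine ⟨hp, ?_⟩
  rw [area2_combo _ _ _ _ hab] at hz
  have hz' : a * (area2 x₁ x₂ p / area2 x₁ x₂ x₃) + b * (area2 x₁ x₂ q / area2 x₁ x₂ x₃) = 0 := by
    rw [← mul_div_assoc, ← mul_div_assoc, ← add_div, hz, zero_div]
  have h1 := mul_nonneg ha.le hp.1
  have h2 := mul_nonneg hb.le hq.1
  have h3 : a * (area2 x₁ x₂ p / area2 x₁ x₂ x₃) = 0 := by linarith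
  rcases mul_eq_zero.1 h3 with h4 | h4
  · exact absurd h4 ha.ne'
  · exact (div_eq_zero_iff.1 h4).resolve_right h

lemma isExtreme_of_mem_triEdges (h : area2 x₁ x₂ x₃ ≠ 0) {e : Set (ℝ × ℝ)}
    (he : e ∈ triEdges x₁ x₂ x₃) : IsExtreme ℝ (triSolid x₁ x₂ x₃) e := by
  have h' : area2 x₂ x₃ x₁ ≠ 0 := by rwa [← area2_rotate]
  have h'' : area2 x₃ x₁ x₂ ≠ 0 := by rwa [area2_rotate]
  rcases he with rfl | rfl | rfl
  · exact isExtreme_segment h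
  · rw [← triSolid_rotate]
    exact isExtreme_segment h'
  · rw [← triSolid_rotate, ← triSolid_rotate]
    exact isExtreme_segment h''

lemma vertex_mem_extremePoints (h : area2 x₁ x₂ x₃ ≠ 0) :
    x₂ ∈ (triSolid x₁ x₂ x₃).extremePoints ℝ := by
  have he₁ : segment ℝ x₁ x₂ ∈ triEdges x₁ x₂ x₃ := Or.inl rfl
  have he₂ : segment ℝ x₂ x₃ ∈ triEdges x₁ x₂ x₃ := Or.inr (Or.inl rfl)
  have hinter : segment ℝ x₁ x₂ ∩ segment ℝ x₂ x₃ = {x₂} := by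
    refine Set.eq_singleton_iff_unique_mem.2
      ⟨⟨right_mem_segment _ _ _, left_mem_segment _ _ _⟩, ?_⟩
    rintro p ⟨hp₁, hp₂⟩
    by_contra hne
    have heq := (isChord_of_mem_triEdges h he₁).eq_of_mem (isChord_of_mem_triEdges h he₂) hne
      hp₁ (right_mem_segment _ _ _) hp₂ (left_mem_segment _ _ _)
    exact h ((isChord_of_mem_triEdges h he₁).area2_eq_zero (left_mem_segment _ _ _)
      (right_mem_segment _ _ _) (heq ▸ right_mem_segment _ _ _))
  rw [← isExtreme_singleton, ← hinter]
  exact (isExtreme_of_mem_triEdges h he₁).inter (isExtreme_of_mem_triEdges h he₂)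

lemma vertices_subset_extremePoints (h : area2 x₁ x₂ x₃ ≠ 0) :
    {x₁, x₂, x₃} ⊆ (triSolid x₁ x₂ x₃).extremePoints ℝ := by
  rintro p (rfl | rfl | rfl)
  · rw [← triSolid_rotate, ← triSolid_rotate]
    exact vertex_mem_extremePoints (by rwa [area2_rotate])
  · exact vertex_mem_extremePoints h
  · rw [← triSolid_rotate]
    exact vertex_mem_extremePoints (by rwa [← area2_rotate])

lemma exists_edge_of_mem_triBdry {p : ℝ × ℝ} (hp : p ∈ triBdry x₁ x₂ x₃) :
    ∃ e ∈ triEdges x₁ x₂ x₃, p ∈ e := by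
  rcases hp with (hp | hp) | hp
  · exact ⟨_, Or.inl rfl, hp⟩
  · exact ⟨_, Or.inr (Or.inl rfl), hp⟩
  · exact ⟨_, Or.inr (Or.inr rfl), hp⟩

lemma convex_of_mem_triEdges {e : Set (ℝ × ℝ)} (he : e ∈ triEdges x₁ x₂ x₃) : Convex ℝ e := by
  rcases he with rfl | rfl | rfl <;> exact convex_segment _ _

/-- A segment leaving the boundary of the triangle cannot be prolonged inside the triangle. -/
lemma not_mem_triSolid_of_one_lt (h : area2 x₁ x₂ x₃ ≠ 0) {a b : ℝ × ℝ}
    (ha : a ∈ triSolid x₁ x₂ x₃) (hb : b ∈ triBdry x₁ x₂ x₃)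
    (hint : ¬ segment ℝ a b ⊆ triBdry x₁ x₂ x₃) {t : ℝ} (ht : 1 < t) :
    a + t • (b - a) ∉ triSolid x₁ x₂ x₃ := by
  intro hp
  obtain ⟨e, he, hbe⟩ := exists_edge_of_mem_triBdry hb
  have ht0 : t ≠ 0 := by linarith
  have hmem : b ∈ openSegment ℝ a (a + t • (b - a)) := by
    rw [openSegment_eq_image']
    refine ⟨t⁻¹, ⟨by positivity, inv_lt_one_of_one_lt₀ ht⟩, ?_⟩
    simp [smul_smul, inv_mul_cancel₀ ht0]
  have hae := (isExtreme_of_mem_triEdges h he).left_mem_of_mem_openSegment ha hp hbe hmem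
  exact hint (((convex_of_mem_triEdges he).segment_subset hae hbe).trans
    (subset_triBdry_of_mem_triEdges he))

lemma exists_smul_of_area2_eq_zero {a b p : ℝ × ℝ} (hab : a ≠ b) (h : area2 a b p = 0) :
    ∃ t : ℝ, p = a + t • (b - a) := by
  have h' : b.1 - a.1 ≠ 0 ∨ b.2 - a.2 ≠ 0 := by
    by_contra! h'
    exact hab (Prod.ext (by linarith [h'.1]) (by linarith [h'.2]))
  simp only [area2] at h
  rcases h' with h' | h'
  · refine ⟨(p.1 - a.1) / (b.1 - a.1), Prod.ext ?_ ?_⟩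
    · simp [div_mul_cancel₀ _ h']
    · simp only [Prod.snd_add, Prod.smul_snd, Prod.snd_sub, smul_eq_mul]
      rw [div_mul_eq_mul_div, ← sub_eq_iff_eq_add', eq_div_iff h']
      linear_combination h
  · refine ⟨(p.2 - a.2) / (b.2 - a.2), Prod.ext ?_ ?_⟩
    · simp only [Prod.fst_add, Prod.smul_fst, Prod.fst_sub, smul_eq_mul]
      rw [div_mul_eq_mul_div, ← sub_eq_iff_eq_add', eq_div_iff h']
      linear_combination -h
    · simp [div_mul_cancel₀ _ h']

lemma isChord_segment (h : area2 x₁ x₂ x₃ ≠ 0) {a b : ℝ × ℝ} (hab : a ≠ b)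
    (ha : a ∈ triBdry x₁ x₂ x₃) (hb : b ∈ triBdry x₁ x₂ x₃)
    (hint : ¬ segment ℝ a b ⊆ triBdry x₁ x₂ x₃) :
    IsChord (triSolid x₁ x₂ x₃) (segment ℝ a b) := by
  have hsub : triBdry x₁ x₂ x₃ ⊆ triSolid x₁ x₂ x₃ := fun p hp => by
    obtain ⟨e, he, hpe⟩ := exists_edge_of_mem_triBdry hp
    exact (isChord_of_mem_triEdges h he).subset hpe
  refine ⟨a, b, hab, Set.Subset.antisymm (fun p hp => ⟨?_, ?_⟩) ?_⟩
  · exact (convex_triSolid _ _ _).segment_subset (hsub ha) (hsub hb) hp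
  · obtain ⟨m, n, -, -, hmn, rfl⟩ := hp
    rw [area2_combo _ _ _ _ hmn]
    simp only [area2]; ring
  · rintro p ⟨hp, hp0⟩
    obtain ⟨t, rfl⟩ := exists_smul_of_area2_eq_zero hab hp0
    rw [segment_eq_image']
    refine ⟨t, ⟨?_, ?_⟩, rfl⟩
    · by_contra! ht
      have e : a + t • (b - a) = b + (1 - t) • (a - b) := by module
      rw [e] at hp
      exact not_mem_triSolid_of_one_lt h (hsub hb) ha (by rwa [segment_symm]) (by linarith) hp
    · by_contra! ht
      exact not_mem_triSolid_of_one_lt h (hsub ha) hb hint ht hp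

lemma area2_ne_zero_of_affineIndependent (h : AffineIndependent ℝ ![x₁, x₂, x₃]) :
    area2 x₁ x₂ x₃ ≠ 0 := by
  intro h0
  have h12 : x₁ ≠ x₂ := fun e => by
    have := h.injective (a₁ := 0) (a₂ := 1) (by simpa using e)
    simp at this
  obtain ⟨t, ht⟩ := exists_smul_of_area2_eq_zero h12 h0
  rw [affineIndependent_iff_not_collinear_set] at h
  apply h
  rw [collinear_iff_of_mem (p₀ := x₁) (by simp)]
  refine ⟨x₂ - x₁, ?_⟩
  rintro p (rfl | rfl | rfl)
  · exact ⟨0, by simp⟩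
  · exact ⟨1, by simp⟩
  · exact ⟨t, by rw [ht, vadd_eq_add, add_comm]⟩

end Triangle

/-- In a triangular arrangement (whenever two segments of `𝒮̄` meet at a point other than
a vertex of the triangle, a unique third segment of `𝒮̄` passes through that point), two
segments of `𝒮` meeting at a point `v` interior to an edge of `T` cannot have their other
endpoints `u`, `w` on a common edge of `T`. -/
theorem triangular_arrangement_no_common_edge
    (x₁ x₂ x₃ : ℝ × ℝ) (hindep : AffineIndependent ℝ ![x₁, x₂, x₃])
    (S : Set (Set (ℝ × ℝ))) (hfin : S.Finite)
    (hwf : ∀ s ∈ S, ∃ a b : ℝ × ℝ, a ≠ b ∧ s = segment ℝ a b ∧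
      a ∈ triBdry x₁ x₂ x₃ ∧ b ∈ triBdry x₁ x₂ x₃ ∧
      ∀ p ∈ openSegment ℝ a b, p ∉ triBdry x₁ x₂ x₃)
    (htriple : ∀ s₁ ∈ S ∪ triEdges x₁ x₂ x₃, ∀ s₂ ∈ S ∪ triEdges x₁ x₂ x₃, s₁ ≠ s₂ →
      ∀ p : ℝ × ℝ, p ∈ s₁ → p ∈ s₂ → p ∉ ({x₁, x₂, x₃} : Set (ℝ × ℝ)) →
      ∃! s₃, s₃ ∈ S ∪ triEdges x₁ x₂ x₃ ∧ s₃ ≠ s₁ ∧ s₃ ≠ s₂ ∧ p ∈ s₃)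
    (v u w : ℝ × ℝ)
    (hv : v ∈ openSegment ℝ x₁ x₂ ∨ v ∈ openSegment ℝ x₂ x₃ ∨ v ∈ openSegment ℝ x₃ x₁)
    (huv : segment ℝ u v ∈ S) (hwv : segment ℝ w v ∈ S)
    (hne : segment ℝ u v ≠ segment ℝ w v) :
    ∀ e ∈ triEdges x₁ x₂ x₃, ¬ (u ∈ e ∧ w ∈ e) := by
  have h := area2_ne_zero_of_affineIndependent hindep
  have hnot : ∀ s ∈ S, ¬ s ⊆ triBdry x₁ x₂ x₃ := by
    rintro s hs hsub
    obtain ⟨a, b, -, rfl, -, -, hint⟩ := hwf s hs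
    have hmid : midpoint ℝ a b ∈ openSegment ℝ a b :=
      ⟨1 / 2, 1 / 2, by norm_num, by norm_num, by norm_num, by
        rw [midpoint_eq_smul_add, smul_add]; norm_num⟩
    exact hint _ hmid (hsub (openSegment_subset_segment _ _ _ hmid))
  have hchord : ∀ s ∈ S ∪ triEdges x₁ x₂ x₃, IsChord (triSolid x₁ x₂ x₃) s := by
    rintro s (hs | hs)
    · obtain ⟨a, b, hab, rfl, ha, hb, -⟩ := hwf s hs
      exact isChord_segment h hab ha hb (hnot _ hs)
    · exact isChord_of_mem_triEdges h hs
  have hthird : ∀ s₁ ∈ S ∪ triEdges x₁ x₂ x₃, ∀ s₂ ∈ S ∪ triEdges x₁ x₂ x₃, s₁ ≠ s₂ →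
      ∀ p ∈ s₁ ∩ s₂, p ∉ (triSolid x₁ x₂ x₃).extremePoints ℝ →
      ∃ s₃ ∈ S ∪ triEdges x₁ x₂ x₃, s₃ ≠ s₁ ∧ s₃ ≠ s₂ ∧ p ∈ s₃ := by
    intro s₁ hs₁ s₂ hs₂ hs p hp hpx
    exact (htriple s₁ hs₁ s₂ hs₂ hs p hp.1 hp.2
      fun hpv => hpx (vertices_subset_extremePoints h hpv)).exists
  have hfin' : (S ∪ triEdges x₁ x₂ x₃).Finite := hfin.union (by simp [triEdges])
  have hsame : ∀ e ∈ triEdges x₁ x₂ x₃, ∀ p, segment ℝ p v ∈ S → v ∈ e → p ∉ e :=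
    fun e he p hp hve hpe => hnot _ hp
      (((convex_of_mem_triEdges he).segment_subset hpe hve).trans
        (subset_triBdry_of_mem_triEdges he))
  have huw : u ≠ w := fun e => hne (by rw [e])
  have hadj : ∀ a b c : ℝ × ℝ, area2 a b c ≠ 0 → segment ℝ a b ∈ triEdges x₁ x₂ x₃ →
      segment ℝ b c ∈ triEdges x₁ x₂ x₃ → v ∈ openSegment ℝ a b →
      ¬ (u ∈ segment ℝ b c ∧ w ∈ segment ℝ b c) := by
    rintro a b c habc hab hbc hv ⟨hu, hw⟩
    have hve := openSegment_subset_segment _ _ _ hv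
    refine no_two_chords_to_adjacent (convex_triSolid _ _ _) hfin' hchord hthird habc
      (Or.inr hab) (Or.inr hbc) hv hu hw ?_ ?_ huw (Or.inl huv) (Or.inl hwv)
    · rintro rfl
      exact hsame _ hab _ huv hve (right_mem_segment _ _ _)
    · rintro rfl
      exact hsame _ hab _ hwv hve (right_mem_segment _ _ _)
  have hedge : ∀ a b c : ℝ × ℝ, area2 a b c ≠ 0 → triEdges a b c = triEdges x₁ x₂ x₃ →
      v ∈ openSegment ℝ a b → ∀ e ∈ triEdges a b c, ¬ (u ∈ e ∧ w ∈ e) := by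
    intro a b c habc hT hv e he hue
    have hab : segment ℝ a b ∈ triEdges x₁ x₂ x₃ := hT ▸ Or.inl rfl
    have hbc : segment ℝ b c ∈ triEdges x₁ x₂ x₃ := hT ▸ Or.inr (Or.inl rfl)
    have hca : segment ℝ c a ∈ triEdges x₁ x₂ x₃ := hT ▸ Or.inr (Or.inr rfl)
    rcases he with rfl | rfl | rfl
    · exact hsame _ hab _ huv (openSegment_subset_segment _ _ _ hv) hue.1
    · exact hadj a b c habc hab hbc hv hue
    · refine hadj b a c ?_ (by rwa [segment_symm]) (by rwa [segment_symm])
        (by rwa [openSegment_symm]) (by rwa [segment_symm])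
      rwa [area2_rotate, area2_swap, neg_ne_zero]
  have hrot : ∀ a b c : ℝ × ℝ, triEdges b c a = triEdges a b c := by
    intro a b c
    ext s
    simp only [triEdges, Set.mem_insert_iff, Set.mem_singleton_iff]
    tauto
  rcases hv with hv | hv | hv
  · exact hedge _ _ _ h rfl hv
  · rw [← hrot]
    exact hedge _ _ _ (by rwa [← area2_rotate]) (hrot _ _ _) hv
  · rw [← hrot, ← hrot]
    exact hedge _ _ _ (by rwa [area2_rotate]) ((hrot _ _ _).trans (hrot _ _ _)) hv
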